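/- arXiv:1909.08159 — 3 statements merged into one kernel-verified Lean document; each statement's English description precedes it below -/
import Mathlib

section
/- Let X be an n×p real matrix with orthonormal columns, i.e. XᵀX = I, and let ω ∈ ℝᵖ be a unit vector (ωᵀω = 1). Then Schur-complement deflation of the columns of X along Xω coincides with projection of the rows of X onto the orthogonal complement of ω; that is, (I − Xωωᵀ Xᵀ / (ωᵀXᵀXω)) · X = X · (I − ωωᵀ). -/
open Matrix

/-- Forward direction of Theorem 1: if `X` has orthonormal columns (`XᵀX = I`)
and `ω` is a unit vector, then Schur-complement deflation of the columns of `X`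
along `Xω` coincides with projection of the rows of `X` onto the orthogonal
complement of `ω`. -/
theorem stmt_3 {n p : ℕ} (X : Matrix (Fin n) (Fin p) ℝ) (ω : Fin p → ℝ)
    (hX : Xᵀ * X = 1) (hω : ω ⬝ᵥ ω = 1) :
    ((1 : Matrix (Fin n) (Fin n) ℝ)
        - (ω ⬝ᵥ ((Xᵀ * X) *ᵥ ω))⁻¹ • vecMulVec (X *ᵥ ω) (X *ᵥ ω)) * X
      = X * ((1 : Matrix (Fin p) (Fin p) ℝ) - vecMulVec ω ω) := by
  have h_row : (X *ᵥ ω) ᵥ* X = ω := by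
    rw [← mulVec_transpose, mulVec_mulVec, hX, one_mulVec]
  rw [hX, one_mulVec, hω, inv_one, one_smul, Matrix.sub_mul, Matrix.mul_sub, Matrix.one_mul,
    Matrix.mul_one, vecMulVec_mul, mul_vecMulVec, h_row]
end

section
/- Let X be an n×p real matrix of rank p, and let ω ∈ ℝᵖ be a unit vector (ωᵀω = 1). If (I − Xωωᵀ Xᵀ / (ωᵀXᵀXω)) · X = X · (I − ωωᵀ), then ωωᵀ (XᵀX) = (ωᵀXᵀXω) · ωωᵀ; equivalently, (XᵀX)ω = (ωᵀXᵀXω) ω, i.e. ω is an eigenvector of XᵀX with eigenvalue ωᵀXᵀXω. -/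
open Matrix

theorem mulVec_ne_zero_of_rank_eq {n p : ℕ} (X : Matrix (Fin n) (Fin p) ℝ)
    (hrank : X.rank = p) {v : Fin p → ℝ} (hv : v ≠ 0) : X *ᵥ v ≠ 0 := by
  have hdim := X.mulVecLin.finrank_range_add_finrank_ker
  rw [← Matrix.rank, hrank, Module.finrank_fin_fun, Nat.add_eq_left,
    Submodule.finrank_eq_zero] at hdim
  exact fun h0 => hv (LinearMap.ker_eq_bot'.mp hdim v h0)

/-- The key cancellation step in the converse direction of Theorem 1:
if `X` has rank `p`, `ω` is a unit vector, and the deflation equality holds,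
then `ωωᵀ (XᵀX) = (ωᵀXᵀXω) ωωᵀ`; equivalently, `ω` is an eigenvector of `XᵀX`
with eigenvalue `ωᵀXᵀXω`. -/
theorem stmt_4 {n p : ℕ} (X : Matrix (Fin n) (Fin p) ℝ) (ω : Fin p → ℝ)
    (hrank : X.rank = p) (hω : ω ⬝ᵥ ω = 1)
    (h : ((1 : Matrix (Fin n) (Fin n) ℝ)
        - (ω ⬝ᵥ ((Xᵀ * X) *ᵥ ω))⁻¹ • vecMulVec (X *ᵥ ω) (X *ᵥ ω)) * X
      = X * ((1 : Matrix (Fin p) (Fin p) ℝ) - vecMulVec ω ω)) :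
    vecMulVec ω ω * (Xᵀ * X) = (ω ⬝ᵥ ((Xᵀ * X) *ᵥ ω)) • vecMulVec ω ω ∧
    (Xᵀ * X) *ᵥ ω = (ω ⬝ᵥ ((Xᵀ * X) *ᵥ ω)) • ω := by
  have hinj : X *ᵥ ω ≠ 0 := mulVec_ne_zero_of_rank_eq X hrank fun h0 => by simp [h0] at hω
  have hgram : (Xᵀ * X) *ᵥ ω = (X *ᵥ ω) ᵥ* X := by
    rw [← mulVec_mulVec, mulVec_transpose]
  have hc : ω ⬝ᵥ ((Xᵀ * X) *ᵥ ω) ≠ 0 := by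
    rw [hgram, dotProduct_comm, ← dotProduct_mulVec]
    exact fun h0 => hinj (dotProduct_self_eq_zero.mp h0)
  have heig : (Xᵀ * X) *ᵥ ω = (ω ⬝ᵥ ((Xᵀ * X) *ᵥ ω)) • ω := by
    rw [Matrix.sub_mul, Matrix.mul_sub, Matrix.one_mul, Matrix.mul_one, sub_right_inj,
      Matrix.smul_mul, vecMulVec_mul, mul_vecMulVec, ← hgram] at h
    obtain ⟨i, hi⟩ := Function.ne_iff.mp hinj
    rw [Pi.zero_apply] at hi
    rw [← inv_smul_eq_iff₀ hc]
    ext j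
    have hij := congrFun (congrFun h i) j
    simp only [Matrix.smul_apply, vecMulVec_apply, smul_eq_mul] at hij
    rw [Pi.smul_apply, smul_eq_mul]
    exact mul_left_cancel₀ hi (by rw [← hij]; ring)
  refine ⟨?_, heig⟩
  have hsymm : ω ᵥ* (Xᵀ * X) = (Xᵀ * X) *ᵥ ω := by
    rw [← mulVec_transpose, transpose_mul, transpose_transpose]
  rw [vecMulVec_mul, hsymm, ← vecMulVec_smul, ← heig]
end

section
/- Let X be an n×p real matrix of rank p. Then the equality (I − Xωωᵀ Xᵀ / (ωᵀXᵀXω)) · X = X · (I − ωωᵀ) holds for every unit vector ω ∈ ℝᵖ if and only if XᵀX = c·I for some real c > 0. -/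
open Matrix

/-- A matrix whose rank is its number of columns acts injectively on vectors. -/
theorem Matrix.mulVec_injective_of_rank_eq_card {m n K : Type*} [Fintype n] [Field K]
    {A : Matrix m n K} (hA : A.rank = Fintype.card n) : Function.Injective A.mulVec := by
  have hker := A.mulVecLin.finrank_range_add_finrank_ker
  rw [show Module.finrank K A.mulVecLin.range = _ from hA, Module.finrank_fintype_fun_eq_card,
    Nat.add_eq_left] at hker
  exact LinearMap.ker_eq_bot.mp (Submodule.finrank_eq_zero.mp hker)

/-- A square matrix for which every nonzero vector is an eigenvector is a scalar matrix. -/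
theorem Matrix.exists_eq_smul_one_of_forall_mulVec_eq_smul {n K : Type*} [Fintype n]
    [DecidableEq n] [Field K] {A : Matrix n n K}
    (hA : ∀ v : n → K, v ≠ 0 → ∃ a : K, A *ᵥ v = a • v) :
    ∃ c : K, A = c • (1 : Matrix n n K) := by
  obtain ⟨c, hc⟩ :=
    A.toLin'.exists_eq_smul_id_of_forall_notLinearIndependent fun v hv => by
      obtain ⟨a, ha⟩ := hA v fun h => hv.ne_zero 0 (by simpa using h)
      have := LinearIndependent.pair_iff.mp hv a (-1) (by simp [ha])
      simp at this
  refine ⟨c, Matrix.toLin'.injective ?_⟩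
  rw [hc, map_smul, Matrix.toLin'_one]
  rfl

/-- The quadratic form of the Gram matrix is the squared length of the image. -/
theorem Matrix.dotProduct_transpose_mul_self_mulVec {m n R : Type*} [Fintype m] [Fintype n]
    [CommSemiring R] (X : Matrix m n R) (v : n → R) :
    v ⬝ᵥ ((Xᵀ * X) *ᵥ v) = (X *ᵥ v) ⬝ᵥ (X *ᵥ v) := by
  rw [← mulVec_mulVec, dotProduct_mulVec, vecMul_transpose]

/-- The outer product with a fixed nonzero left factor is injective in the right factor. -/
theorem Matrix.vecMulVec_right_injective {m n R : Type*} [MulZeroClass R] [IsLeftCancelMulZero R]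
    {u : m → R} (hu : u ≠ 0) : Function.Injective (vecMulVec u : (n → R) → Matrix m n R) := by
  intro v w h
  obtain ⟨i, hi⟩ := Function.ne_iff.mp hu
  exact funext fun j => mul_left_cancel₀ hi (congrFun (congrFun h i) j)

/-- Column deflation of `X` along `X *ᵥ v` agrees with row deflation along `v` exactly when `v`
is an eigenvector of the Gram matrix. -/
theorem Matrix.column_deflation_eq_row_deflation_iff {m n K : Type*} [Fintype m] [Fintype n]
    [DecidableEq m] [DecidableEq n] [Field K] (X : Matrix m n K) {v : n → K} {a : K}
    (ha : a ≠ 0) (hv : X *ᵥ v ≠ 0) :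
    (1 - a⁻¹ • vecMulVec (X *ᵥ v) (X *ᵥ v)) * X = X * (1 - vecMulVec v v) ↔
      (Xᵀ * X) *ᵥ v = a • v := by
  rw [Matrix.sub_mul, Matrix.mul_sub, Matrix.one_mul, Matrix.mul_one, sub_right_inj,
    Matrix.smul_mul, vecMulVec_mul, mul_vecMulVec, ← vecMulVec_smul,
    (vecMulVec_right_injective hv).eq_iff, inv_smul_eq_iff₀ ha, ← mulVec_transpose, mulVec_mulVec]

/-- Quantified (corrected) form of Theorem 1: for a rank-`p` matrix `X`, the
Schur-complement deflation of the columns of `X` along `Xω` agrees with the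
decision-direction deflation of its rows for every unit vector `ω` iff
`XᵀX = c I` for some `c > 0`. -/
theorem stmt_6 {n p : ℕ} (X : Matrix (Fin n) (Fin p) ℝ) (hrank : X.rank = p) :
    (∀ ω : Fin p → ℝ, ω ⬝ᵥ ω = 1 →
      ((1 : Matrix (Fin n) (Fin n) ℝ)
          - (ω ⬝ᵥ ((Xᵀ * X) *ᵥ ω))⁻¹ • vecMulVec (X *ᵥ ω) (X *ᵥ ω)) * X
        = X * ((1 : Matrix (Fin p) (Fin p) ℝ) - vecMulVec ω ω))
    ↔ ∃ c : ℝ, 0 < c ∧ Xᵀ * X = c • (1 : Matrix (Fin p) (Fin p) ℝ) := by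
  have hX : ∀ v : Fin p → ℝ, v ≠ 0 → X *ᵥ v ≠ 0 := fun v hv h =>
    hv (mulVec_injective_of_rank_eq_card (by simpa using hrank) (by simpa using h))
  have hpos : ∀ v : Fin p → ℝ, v ≠ 0 → 0 < v ⬝ᵥ ((Xᵀ * X) *ᵥ v) := fun v hv => by
    rw [dotProduct_transpose_mul_self_mulVec]
    simpa using dotProduct_star_self_pos_iff.mpr (hX v hv)
  have hunit : ∀ v : Fin p → ℝ, v ⬝ᵥ v = 1 → v ≠ 0 := by
    rintro v hv rfl
    simp at hv
  constructor
  · intro h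
    obtain ⟨c, hc⟩ : ∃ c : ℝ, Xᵀ * X = c • (1 : Matrix (Fin p) (Fin p) ℝ) := by
      refine exists_eq_smul_one_of_forall_mulVec_eq_smul fun v hv => ?_
      have hvv : 0 < v ⬝ᵥ v := by simpa using dotProduct_star_self_pos_iff.mpr hv
      set r := √(v ⬝ᵥ v)
      have hr : r ≠ 0 := (Real.sqrt_pos.mpr hvv).ne'
      have hω : (r⁻¹ • v) ⬝ᵥ (r⁻¹ • v) = 1 := by
        rw [smul_dotProduct, dotProduct_smul, ← Real.mul_self_sqrt hvv.le, smul_eq_mul,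
          smul_eq_mul, inv_mul_cancel_left₀ hr, inv_mul_cancel₀ hr]
      have hω0 := hunit _ hω
      have heig := (column_deflation_eq_row_deflation_iff X (hpos _ hω0).ne' (hX _ hω0)).mp
        (h _ hω)
      rw [mulVec_smul, smul_comm _ r⁻¹ v] at heig
      exact ⟨_, smul_right_injective _ (inv_ne_zero hr) heig⟩
    rcases isEmpty_or_nonempty (Fin p) with _ | ⟨⟨i⟩⟩
    · exact ⟨1, one_pos, Subsingleton.elim _ _⟩
    · refine ⟨c, ?_, hc⟩
      simpa [hc, smul_mulVec] using hpos (Pi.single i 1) (by simp)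
  · rintro ⟨c, -, hc⟩ ω hω
    have hω0 := hunit ω hω
    refine (column_deflation_eq_row_deflation_iff X (hpos ω hω0).ne' (hX ω hω0)).mpr ?_
    simp [hc, smul_mulVec, hω]
end
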